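/- arXiv:0909.5346 — 5 statements merged into one kernel-verified Lean document; each statement's English description precedes it below -/
import Mathlib

section
/- Let m ≥ 1 and let Ω ⊆ ℝ^m be a Lebesgue-measurable set of finite Lebesgue measure. Let Ω* be the closed Euclidean ball in ℝ^m centered at the origin whose Lebesgue measure equals that of Ω. Then ∫_Ω ‖x‖² dx ≥ ∫_{Ω*} ‖x‖² dx. -/
open MeasureTheory Metric

/-- For a Lebesgue-measurable set `Ω ⊆ ℝ^m` of finite Lebesgue measure,
if `Ω*` is the closed Euclidean ball centered at the origin with the same measure as `Ω`,
then `∫_Ω ‖x‖² dx ≥ ∫_{Ω*} ‖x‖² dx`. -/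
theorem moment_of_inertia_ball_min
    (m : ℕ) (hm : 1 ≤ m)
    (Ω : Set (EuclideanSpace ℝ (Fin m)))
    (hΩmeas : MeasurableSet Ω) (hΩfin : volume Ω < ⊤)
    (R : ℝ) (hR : 0 ≤ R)
    (hvol : volume (closedBall (0 : EuclideanSpace ℝ (Fin m)) R) = volume Ω) :
    ∫⁻ x in closedBall (0 : EuclideanSpace ℝ (Fin m)) R, ENNReal.ofReal (‖x‖ ^ 2)
      ≤ ∫⁻ x in Ω, ENNReal.ofReal (‖x‖ ^ 2) := by
  set B := closedBall (0 : EuclideanSpace ℝ (Fin m)) R with hB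
  have hBm : MeasurableSet B := isClosed_closedBall.measurableSet
  have hdiff : volume (B \ Ω) = volume (Ω \ B) := by
    have h1 := measure_inter_add_diff (μ := volume) B hΩmeas
    have h2 := measure_inter_add_diff (μ := volume) Ω hBm
    rw [Set.inter_comm] at h2
    have hfin : volume (B ∩ Ω) ≠ ⊤ :=
      ((measure_mono Set.inter_subset_right).trans_lt hΩfin).ne
    have h3 : volume (B ∩ Ω) + volume (B \ Ω) = volume (B ∩ Ω) + volume (Ω \ B) := by
      rw [h1, h2, hvol]
    exact (ENNReal.add_right_inj hfin).1 h3
  rw [← lintegral_inter_add_diff (μ := volume) _ B hΩmeas,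
    ← lintegral_inter_add_diff (μ := volume) _ Ω hBm, Set.inter_comm Ω B]
  refine add_le_add le_rfl ?_
  calc ∫⁻ x in B \ Ω, ENNReal.ofReal (‖x‖ ^ 2)
      ≤ ∫⁻ _ in B \ Ω, ENNReal.ofReal (R ^ 2) := by
        refine setLIntegral_mono measurable_const fun x hx => ?_
        have hx1 : ‖x‖ ≤ R := mem_closedBall_zero_iff.1 hx.1
        exact ENNReal.ofReal_le_ofReal (by gcongr)
    _ = ∫⁻ _ in Ω \ B, ENNReal.ofReal (R ^ 2) := by
        rw [setLIntegral_const, setLIntegral_const, hdiff]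
    _ ≤ ∫⁻ x in Ω \ B, ENNReal.ofReal (‖x‖ ^ 2) := by
        refine setLIntegral_mono (by fun_prop) fun x hx => ?_
        have hx1 : R ≤ ‖x‖ := by
          by_contra hlt
          exact hx.2 (mem_closedBall_zero_iff.2 (not_le.1 hlt).le)
        exact ENNReal.ofReal_le_ofReal (by gcongr)
end

section
/- Let m ≥ 1 and let Ω ⊆ ℝ^m be a Lebesgue-measurable set of finite Lebesgue measure. Then ∫_Ω ‖x‖² dx ≥ (Vol(Ω)/ω_m)^{(m+2)/m} · ∫_{B^m} ‖x‖² dx, where B^m is the closed unit ball in ℝ^m centered at the origin, ω_m = Vol(B^m) is its Lebesgue measure, and Vol denotes Lebesgue measure on ℝ^m. -/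
open MeasureTheory Metric

lemma scaling_aux (m : ℕ) (r : ℝ) (hr : 0 < r) :
    ENNReal.ofReal (r ^ (m + 2)) *
      ∫⁻ x in closedBall (0 : EuclideanSpace ℝ (Fin m)) 1, ENNReal.ofReal (‖x‖ ^ 2)
      = ∫⁻ x in closedBall (0 : EuclideanSpace ℝ (Fin m)) r, ENNReal.ofReal (‖x‖ ^ 2) := by
  have hmeas : Measurable fun x : EuclideanSpace ℝ (Fin m) => ENNReal.ofReal (‖x‖ ^ 2) := by
    fun_prop
  have h1 := Measure.map_addHaar_smul (volume : Measure (EuclideanSpace ℝ (Fin m))) hr.ne'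
  have h2 : ∫⁻ x in closedBall (0 : EuclideanSpace ℝ (Fin m)) r, ENNReal.ofReal (‖x‖ ^ 2)
      ∂(Measure.map (r • ·) volume)
      = ∫⁻ x in closedBall (0 : EuclideanSpace ℝ (Fin m)) 1, ENNReal.ofReal (‖r • x‖ ^ 2) := by
    rw [setLIntegral_map measurableSet_closedBall hmeas (measurable_const_smul r)]
    congr 2
    ext x
    simp [norm_smul, abs_of_pos hr, hr]
  rw [h1, Measure.restrict_smul, lintegral_smul_measure] at h2
  have h3 : ∫⁻ x in closedBall (0 : EuclideanSpace ℝ (Fin m)) 1, ENNReal.ofReal (‖r • x‖ ^ 2)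
      = ENNReal.ofReal (r ^ 2) *
        ∫⁻ x in closedBall (0 : EuclideanSpace ℝ (Fin m)) 1, ENNReal.ofReal (‖x‖ ^ 2) := by
    rw [← lintegral_const_mul _ hmeas]
    congr 1
    ext x
    rw [← ENNReal.ofReal_mul (by positivity), norm_smul, mul_pow, Real.norm_eq_abs, sq_abs]
  rw [h3] at h2
  rw [pow_add, ENNReal.ofReal_mul (by positivity), mul_assoc, ← h2, smul_eq_mul, ← mul_assoc,
    ← ENNReal.ofReal_mul (by positivity)]
  have : r ^ m * |(r ^ Module.finrank ℝ (EuclideanSpace ℝ (Fin m)))⁻¹| = 1 := by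
    rw [finrank_euclideanSpace_fin, abs_of_pos (by positivity)]
    field_simp
  rw [this]; simp

lemma compare_aux (m : ℕ) (r : ℝ) (hr : 0 < r) (Ω : Set (EuclideanSpace ℝ (Fin m)))
    (hΩmeas : MeasurableSet Ω) (hΩfin : volume Ω < ⊤)
    (hv : volume (closedBall (0 : EuclideanSpace ℝ (Fin m)) r) = volume Ω) :
    ∫⁻ x in closedBall (0 : EuclideanSpace ℝ (Fin m)) r, ENNReal.ofReal (‖x‖ ^ 2)
      ≤ ∫⁻ x in Ω, ENNReal.ofReal (‖x‖ ^ 2) := by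
  set B := closedBall (0 : EuclideanSpace ℝ (Fin m)) r with hB
  have hBm : MeasurableSet B := measurableSet_closedBall
  rw [← lintegral_inter_add_sdiff _ B hΩmeas, ← lintegral_inter_add_sdiff _ Ω hBm,
    Set.inter_comm B Ω]
  refine add_le_add le_rfl ?_
  have hd : volume (B \ Ω) = volume (Ω \ B) := by
    have e1 := measure_inter_add_sdiff (μ := volume) B hΩmeas
    have e2 := measure_inter_add_sdiff (μ := volume) Ω hBm
    rw [Set.inter_comm, hv, ← e2] at e1
    exact (ENNReal.add_right_inj
      ((measure_mono Set.inter_subset_left).trans_lt hΩfin).ne).1 e1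
  calc _ ≤ ∫⁻ x in B \ Ω, ENNReal.ofReal (r ^ 2) := by
        apply setLIntegral_mono measurable_const
        intro x hx
        have : ‖x‖ ≤ r := by simpa [hB] using hx.1
        gcongr
    _ = ∫⁻ x in Ω \ B, ENNReal.ofReal (r ^ 2) := by
        simp only [setLIntegral_const, hd]
    _ ≤ _ := by
        apply setLIntegral_mono (by fun_prop)
        intro x hx
        have : r < ‖x‖ := by simpa [hB] using hx.2
        gcongr

/-- For a Lebesgue-measurable set `Ω ⊆ ℝ^m` of finite Lebesgue measure,
`∫_Ω ‖x‖² dx ≥ (Vol(Ω)/ω_m)^((m+2)/m) · ∫_{B^m} ‖x‖² dx`, where `B^m` is the closed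
unit ball centered at the origin and `ω_m` its Lebesgue measure. -/
theorem moment_of_inertia_lower_bound
    (m : ℕ) (hm : 1 ≤ m)
    (Ω : Set (EuclideanSpace ℝ (Fin m)))
    (hΩmeas : MeasurableSet Ω) (hΩfin : volume Ω < ⊤) :
    (volume Ω / volume (closedBall (0 : EuclideanSpace ℝ (Fin m)) 1))
        ^ (((m : ℝ) + 2) / m)
      * ∫⁻ x in closedBall (0 : EuclideanSpace ℝ (Fin m)) 1, ENNReal.ofReal (‖x‖ ^ 2)
      ≤ ∫⁻ x in Ω, ENNReal.ofReal (‖x‖ ^ 2) := by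
  have hm0 : (0 : ℝ) < m := by exact_mod_cast hm
  have hω0 : volume (closedBall (0 : EuclideanSpace ℝ (Fin m)) 1) ≠ 0 :=
    (measure_closedBall_pos _ _ one_pos).ne'
  have hωt : volume (closedBall (0 : EuclideanSpace ℝ (Fin m)) 1) ≠ ⊤ :=
    measure_closedBall_lt_top.ne
  by_cases h0 : volume Ω = 0
  · rw [h0, ENNReal.zero_div, ENNReal.zero_rpow_of_pos (by positivity), zero_mul]
    exact zero_le
  set q := volume Ω / volume (closedBall (0 : EuclideanSpace ℝ (Fin m)) 1) with hq
  have hqt : q ≠ ⊤ := ENNReal.div_ne_top hΩfin.ne hω0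
  have hq0 : q ≠ 0 := ENNReal.div_ne_zero.2 ⟨h0, hωt⟩
  have htp : 0 < q.toReal := ENNReal.toReal_pos hq0 hqt
  set r := q.toReal ^ ((1 : ℝ) / m) with hr
  have hrp : 0 < r := Real.rpow_pos_of_pos htp _
  have hrm : r ^ m = q.toReal := by
    rw [hr, ← Real.rpow_natCast, ← Real.rpow_mul htp.le, one_div_mul_cancel hm0.ne',
      Real.rpow_one]
  have hrm2 : ENNReal.ofReal (r ^ (m + 2)) = q ^ (((m : ℝ) + 2) / m) := by
    rw [hr, ← Real.rpow_natCast, ← Real.rpow_mul htp.le,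
      ← ENNReal.ofReal_rpow_of_pos htp, ENNReal.ofReal_toReal hqt]
    congr 1
    push_cast
    ring
  rw [← hrm2, scaling_aux m r hrp]
  apply compare_aux m r hrp Ω hΩmeas hΩfin
  rw [Measure.addHaar_closedBall' _ _ hrp.le, finrank_euclideanSpace_fin, hrm,
    ENNReal.ofReal_toReal hqt, hq, ENNReal.div_mul_cancel hω0 hωt]
end

section
/- Let n ≥ 1 be an integer, μ a Borel measure on ℝ^n with 0 < ω := μ(ℝ^n) < ∞, K a positive integer, α a positive real number with α ≤ ω/(2·8^n·K), and r > 0 a real number such that 2·8^n·μ(B(x,r)) ≤ α for every x ∈ ℝ^n, where B(x,r) is the open Euclidean ball of center x and radius r. Then there exist K measurable subsets A_1, …, A_K of ℝ^n such that μ(A_i) ≥ α for each i, and d(A_i, A_j) ≥ 3r for all i ≠ j, where d(A,B) = inf{‖a−b‖ : a ∈ A, b ∈ B} is the Euclidean distance between sets. -/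
open MeasureTheory Metric

/-- The union of the balls of radius `ρ` centered at points of `s`. -/
def ballUnion {n : ℕ} (s : Finset (EuclideanSpace ℝ (Fin n))) (ρ : ℝ) :
    Set (EuclideanSpace ℝ (Fin n)) := ⋃ x ∈ s, ball x ρ

lemma isOpen_ballUnion {n : ℕ} (s : Finset (EuclideanSpace ℝ (Fin n))) (ρ : ℝ) :
    IsOpen (ballUnion s ρ) := isOpen_biUnion fun _ _ => isOpen_ball

/-- Averaging over translations: fractional covering of balls of radius `4r`. -/
lemma averaging {n : ℕ} (ν : Measure (EuclideanSpace ℝ (Fin n))) [IsFiniteMeasure ν]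
    (r : ℝ) (hr : 0 < r) (s : Finset (EuclideanSpace ℝ (Fin n))) (M : ENNReal)
    (hM : ∀ v, ν (ballUnion (s.map (addRightEmbedding v)) r) ≤ M) :
    ν (ballUnion s (4 * r)) ≤ 5 ^ n * M := by
  let T : Set (EuclideanSpace ℝ (Fin n) × EuclideanSpace ℝ (Fin n)) := {p | p.2 ∈ ballUnion (s.map (addRightEmbedding p.1)) r}
  have hT : IsOpen T := by
    have : T = ⋃ x ∈ s, {p : EuclideanSpace ℝ (Fin n) × EuclideanSpace ℝ (Fin n) | dist p.2 (x + p.1) < r} := by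
      ext p; simp [T, ballUnion]
    rw [this]
    refine isOpen_biUnion fun x _ => isOpen_lt ?_ continuous_const
    fun_prop
  let B : Measure (EuclideanSpace ℝ (Fin n)) := volume.restrict (ball 0 (5 * r))
  have h1 : (B.prod ν) T ≤ M * volume (ball (0 : EuclideanSpace ℝ (Fin n)) (5 * r)) := by
    rw [Measure.prod_apply hT.measurableSet]
    calc ∫⁻ v, ν (Prod.mk v ⁻¹' T) ∂B ≤ ∫⁻ v, M ∂B := lintegral_mono fun v => hM v
      _ = _ := by simp [B]
  have h2 : volume (ball (0 : EuclideanSpace ℝ (Fin n)) r) * ν (ballUnion s (4 * r)) ≤ (B.prod ν) T := by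
    rw [Measure.prod_apply_symm hT.measurableSet]
    calc volume (ball (0 : EuclideanSpace ℝ (Fin n)) r) * ν (ballUnion s (4 * r))
        = ∫⁻ y in ballUnion s (4 * r), volume (ball (0 : EuclideanSpace ℝ (Fin n)) r) ∂ν := by simp
      _ ≤ ∫⁻ y in ballUnion s (4 * r), B ((fun v => (v, y)) ⁻¹' T) ∂ν := by
        refine setLIntegral_mono' (isOpen_ballUnion _ _).measurableSet fun y hy => ?_
        simp only [ballUnion, Set.mem_iUnion, mem_ball] at hy
        obtain ⟨x, hx, hxy⟩ := hy
        have hm : MeasurableSet ((fun v => (v, y)) ⁻¹' T) :=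
          (hT.preimage (by fun_prop)).measurableSet
        rw [Measure.restrict_apply hm, ← Measure.addHaar_ball_center volume (y - x) r]
        refine measure_mono fun v hv => ⟨?_, ?_⟩
        · simp only [Set.mem_preimage, T, ballUnion, Finset.mem_map,
            Set.mem_iUnion]
          refine ⟨x + v, ⟨x, hx, rfl⟩, ?_⟩
          rw [mem_ball, dist_eq_norm] at hv ⊢
          rw [← norm_neg]
          have e : -(y - (x + v)) = v - (y - x) := by abel
          rw [e]
          exact hv
        · rw [mem_ball, dist_eq_norm] at hv ⊢
          rw [dist_eq_norm] at hxy
          have := norm_add_le (v - (y - x)) (y - x)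
          simp only [sub_add_cancel, sub_zero] at *
          linarith
      _ ≤ _ := setLIntegral_le_lintegral _ _
  have h3 : volume (ball (0 : EuclideanSpace ℝ (Fin n)) (5 * r)) = 5 ^ n * volume (ball (0 : EuclideanSpace ℝ (Fin n)) r) := by
    rw [Measure.addHaar_ball_mul_of_pos volume (0 : EuclideanSpace ℝ (Fin n)) (by norm_num : (0 : ℝ) < 5) r]
    simp [ENNReal.ofReal_pow]
  have h4 := h2.trans h1
  rw [h3] at h4
  have hv0 : volume (ball (0 : EuclideanSpace ℝ (Fin n)) r) ≠ 0 := (measure_ball_pos volume _ hr).ne'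
  have hvt : volume (ball (0 : EuclideanSpace ℝ (Fin n)) r) ≠ ⊤ := measure_ball_lt_top.ne
  rw [show M * (5 ^ n * volume (ball (0 : EuclideanSpace ℝ (Fin n)) r)) = volume (ball (0 : EuclideanSpace ℝ (Fin n)) r) * (5 ^ n * M) by ring]
    at h4
  exact (ENNReal.mul_le_mul_iff_right hv0 hvt).1 h4

lemma step {n : ℕ} (ν : Measure (EuclideanSpace ℝ (Fin n))) [IsFiniteMeasure ν]
    (α : ℝ) (hα : 0 < α) (r : ℝ) (hr : 0 < r)
    (hball : ∀ x, 2 * 8 ^ n * ν.real (ball x r) ≤ α)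
    (hu : α < ν.real Set.univ) :
    ∃ s : Finset (EuclideanSpace ℝ (Fin n)), α ≤ ν.real (ballUnion s r) ∧
      ν.real (ballUnion s (4 * r)) ≤ 2 * 8 ^ n * α := by
  classical
  have hex : ∃ k, ∃ s : Finset (EuclideanSpace ℝ (Fin n)), s.card = k ∧ α ≤ ν.real (ballUnion s r) := by
    let u := TopologicalSpace.denseSeq (EuclideanSpace ℝ (Fin n))
    let f : ℕ → Set (EuclideanSpace ℝ (Fin n)) := fun N => ballUnion ((Finset.range N).image u) r
    have hf : Monotone f := by
      intro a b hab
      refine Set.biUnion_subset_biUnion_left ?_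
      intro x hx
      obtain ⟨i, hi, rfl⟩ := Finset.mem_image.1 (Finset.mem_coe.1 hx)
      rw [Finset.mem_range] at hi
      exact Finset.mem_coe.2 (Finset.mem_image.2 ⟨i, Finset.mem_range.2 (hi.trans_le hab), rfl⟩)
    have hU : ⋃ N, f N = Set.univ := by
      refine Set.eq_univ_of_forall fun y => ?_
      obtain ⟨i, hi⟩ := (TopologicalSpace.denseRange_denseSeq (EuclideanSpace ℝ (Fin n))).exists_dist_lt y hr
      simp only [f, ballUnion, Set.mem_iUnion]
      exact ⟨i + 1, u i, Finset.mem_image.2 ⟨i, by simp, rfl⟩, hi⟩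
    have ht := tendsto_measure_iUnion_atTop (μ := ν) hf
    rw [hU] at ht
    have ht' := (ENNReal.tendsto_toReal (measure_ne_top ν _)).comp ht
    obtain ⟨N, hN⟩ := (ht'.eventually (lt_mem_nhds hu)).exists
    exact ⟨_, _, rfl, hN.le⟩
  obtain ⟨s, hs, hsα⟩ := Nat.find_spec hex
  refine ⟨s, hsα, ?_⟩
  have h8 : (1 : ℝ) ≤ 8 ^ n := one_le_pow₀ (by norm_num)
  have hk : ∀ t : Finset (EuclideanSpace ℝ (Fin n)), t.card = s.card → ν.real (ballUnion t r) ≤ 3 / 2 * α := by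
    intro t ht
    rcases t.eq_empty_or_nonempty with rfl | ⟨x, hx⟩
    · simp [ballUnion]; positivity
    have h1 : ν.real (ballUnion (t.erase x) r) < α := by
      by_contra! hc
      refine Nat.find_min hex (m := (t.erase x).card) ?_ ⟨_, rfl, hc⟩
      rw [← hs, ← ht]
      exact Finset.card_erase_lt_of_mem hx
    have h2 : ballUnion t r ⊆ ball x r ∪ ballUnion (t.erase x) r := by
      intro y hy
      simp only [ballUnion, Set.mem_iUnion, Set.mem_union, Finset.mem_erase] at *
      obtain ⟨z, hz, hzy⟩ := hy
      by_cases h : z = x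
      · left; rwa [← h]
      · right; exact ⟨z, ⟨h, hz⟩, hzy⟩
    have h3 := (measureReal_mono (μ := ν) h2).trans (measureReal_union_le _ _)
    have h4 := hball x
    have h5 : 0 ≤ ν.real (ball x r) := measureReal_nonneg
    nlinarith
  have h := averaging ν r hr s (ENNReal.ofReal (3 / 2 * α)) (fun v => by
    rw [← ofReal_measureReal (μ := ν)]
    exact ENNReal.ofReal_le_ofReal (hk _ (Finset.card_map _)))
  have h' := ENNReal.toReal_mono (by finiteness) h
  rw [ENNReal.toReal_mul, ENNReal.toReal_ofReal (by positivity)] at h'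
  simp only [ENNReal.toReal_pow, ENNReal.toReal_ofNat] at h'
  have h58 : (5 : ℝ) ^ n ≤ 8 ^ n := pow_le_pow_left₀ (by norm_num) (by norm_num) n
  change (ν _).toReal ≤ _
  nlinarith

lemma main_induction {n : ℕ} (α : ℝ) (hα : 0 < α) (r : ℝ) (hr : 0 < r) (K : ℕ) :
    ∀ (ν : Measure (EuclideanSpace ℝ (Fin n))) [IsFiniteMeasure ν],
    (∀ x, 2 * 8 ^ n * ν.real (ball x r) ≤ α) → K * (2 * 8 ^ n * α) ≤ ν.real Set.univ →
    ∃ A : Fin K → Set (EuclideanSpace ℝ (Fin n)),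
      (∀ i, MeasurableSet (A i)) ∧
      (∀ i, α ≤ ν.real (A i)) ∧
      (∀ i j, i ≠ j → ∀ a ∈ A i, ∀ b ∈ A j, 3 * r ≤ dist a b) := by
  induction K with
  | zero => intro ν _ _ _; exact ⟨fun _ => ∅, fun i => i.elim0, fun i => i.elim0, fun i => i.elim0⟩
  | succ K ih =>
    intro ν _ hb hu
    have h8 : (1 : ℝ) ≤ 8 ^ n := one_le_pow₀ (by norm_num)
    have hpos : 0 ≤ (K : ℝ) * (2 * 8 ^ n * α) := by positivity
    push_cast at hu
    obtain ⟨s, hs1, hs2⟩ := step ν α hα r hr hb (by nlinarith)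
    set D := ballUnion s (4 * r) with hD
    have hDm : MeasurableSet D := (isOpen_ballUnion _ _).measurableSet
    obtain ⟨A, hA1, hA2, hA3⟩ := ih (ν.restrict Dᶜ)
      (fun x => by
        refine le_trans ?_ (hb x)
        gcongr
        exact ENNReal.toReal_mono (measure_ne_top _ _) (Measure.restrict_apply_le _ _))
      (by
        rw [measureReal_restrict_apply MeasurableSet.univ, Set.univ_inter,
          measureReal_compl hDm]
        linarith)
    have key : ∀ a ∈ ballUnion s r, ∀ b ∈ Dᶜ, 3 * r ≤ dist a b := by
      intro a ha b hb
      simp only [hD, ballUnion, Set.mem_iUnion, Set.mem_compl_iff, mem_ball, not_exists,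
        not_lt] at ha hb
      obtain ⟨x, hx, hax⟩ := ha
      have h1 := hb x hx
      have h2 := dist_triangle_left b x a
      linarith
    refine ⟨Fin.cons (ballUnion s r) fun i => A i ∩ Dᶜ, ?_, ?_, ?_⟩
    · intro i
      refine Fin.cases ?_ (fun i => ?_) i
      · exact (isOpen_ballUnion _ _).measurableSet
      · exact (hA1 i).inter hDm.compl
    · intro i
      refine Fin.cases ?_ (fun i => ?_) i
      · exact hs1
      · have := hA2 i
        rw [measureReal_restrict_apply (hA1 i)] at this
        exact this
    · intro i j
      refine Fin.cases ?_ (fun i => ?_) i <;> refine Fin.cases ?_ (fun j => ?_) j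
      · intro h; exact absurd rfl h
      · intro _ a ha b hb
        exact key a ha b hb.2
      · intro _ a ha b hb
        rw [dist_comm]
        exact key b hb a ha.2
      · intro h a ha b hb
        exact hA3 i j (fun e => h (by rw [e])) a ha.1 b hb.1

/-- Colbois–Maerten type decomposition: Given a finite nonzero Borel
measure `μ` on `ℝ^n`, a positive integer `K`, a real `α > 0` with
`α ≤ ω/(2·8^n·K)` where `ω = μ(ℝ^n)`, and `r > 0` such that
`2·8^n·μ(B(x,r)) ≤ α` for all `x`, there are `K` measurable sets `A_1,…,A_K` with
`μ(A_i) ≥ α` and `d(A_i,A_j) ≥ 3r` for `i ≠ j`. -/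
theorem exists_separated_sets_of_measure
    (n : ℕ) (hn : 1 ≤ n)
    (μ : Measure (EuclideanSpace ℝ (Fin n)))
    (hμ0 : μ Set.univ ≠ 0) (hμfin : μ Set.univ ≠ ⊤)
    (K : ℕ) (hK : 1 ≤ K)
    (α : ℝ) (hα : 0 < α)
    (hαω : α ≤ (μ Set.univ).toReal / (2 * 8 ^ n * K))
    (r : ℝ) (hr : 0 < r)
    (hball : ∀ x : EuclideanSpace ℝ (Fin n),
      2 * 8 ^ n * (μ (ball x r)).toReal ≤ α) :
    ∃ A : Fin K → Set (EuclideanSpace ℝ (Fin n)),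
      (∀ i, MeasurableSet (A i)) ∧
      (∀ i, α ≤ (μ (A i)).toReal) ∧
      (∀ i j, i ≠ j → ∀ a ∈ A i, ∀ b ∈ A j, 3 * r ≤ dist a b) := by
  have : IsFiniteMeasure μ := ⟨lt_top_iff_ne_top.2 hμfin⟩
  refine main_induction α hα r hr K μ hball ?_
  have hK' : (0 : ℝ) < K := by exact_mod_cast hK
  rw [le_div_iff₀ (by positivity)] at hαω
  change _ ≤ (μ _).toReal
  linarith
end

section
/- Let m ≥ 1 and n ≥ 1 be integers, μ a Borel measure on ℝ^n with 0 < V := μ(ℝ^n) < ∞, L > 0 a real number such that μ(B(x,r)) ≤ L·r^m for every x ∈ ℝ^n and every r > 0, and k ≥ 1 an integer. Set r₀ = (V/(12·8^{2n}·L·k))^{1/m}. Then there exist k+1 measurable subsets A_1, …, A_{k+1} of ℝ^n such that: (i) μ(A_i) ≥ V/(6·8^n·k) for each i; (ii) μ(A_i^{r₀}) ≤ V/k for each i, where A^{r₀} is the open r₀-neighborhood of A; and (iii) d(A_i, A_j) ≥ 3r₀ for all i ≠ j. -/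
open MeasureTheory Metric

/-- Averaging over translations: if every translate of a union of `r`-balls has small measure,
then the union of the `4r`-balls has measure at most `5^n` times as much. -/
lemma aux_average {n : ℕ} (ν : Measure (EuclideanSpace ℝ (Fin n))) [IsFiniteMeasure ν]
    (r : ℝ) (hr : 0 < r) (S : Finset (EuclideanSpace ℝ (Fin n))) (M : ENNReal)
    (hM : ∀ t, ν (⋃ x ∈ S, ball (x + t) r) ≤ M) :
    ν (⋃ x ∈ S, ball x (4 * r)) ≤ 5 ^ n * M := by
  let E := EuclideanSpace ℝ (Fin n)
  set W : Set (E × E) := ⋃ x ∈ S, {p : E × E | dist p.2 (x + p.1) < r} with hW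
  have hWo : IsOpen W := by
    refine isOpen_biUnion fun x _ => ?_
    exact isOpen_lt (by fun_prop) (by fun_prop)
  have hWm : MeasurableSet W := hWo.measurableSet
  set U : Set E := ⋃ x ∈ S, ball x (4 * r) with hU
  have hUm : MeasurableSet U := (isOpen_biUnion fun x _ => isOpen_ball).measurableSet
  let lam : Measure E := (volume : Measure E).restrict (ball 0 (5 * r))
  have hfin : IsFiniteMeasure lam :=
    ⟨by simpa [lam] using measure_ball_lt_top⟩
  have h1 : (lam.prod ν) W ≤ M * volume (ball (0 : E) (5 * r)) := by
    rw [Measure.prod_apply hWm]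
    calc ∫⁻ t, ν (Prod.mk t ⁻¹' W) ∂lam ≤ ∫⁻ t, M ∂lam := by
          refine lintegral_mono fun t => ?_
          refine le_trans (measure_mono ?_) (hM t)
          intro y hy
          simp only [hW, Set.mem_preimage, Set.mem_iUnion, exists_prop] at hy
          obtain ⟨x, hx, hxy⟩ := hy
          simp only [Set.mem_iUnion, exists_prop]
          exact ⟨x, hx, hxy⟩
      _ = M * volume (ball (0 : E) (5 * r)) := by
          simp [lam]
  have h2 : volume (ball (0 : E) r) * ν U ≤ (lam.prod ν) W := by
    rw [Measure.prod_apply_symm hWm]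
    calc volume (ball (0 : E) r) * ν U = ∫⁻ y in U, volume (ball (0 : E) r) ∂ν := by simp
      _ ≤ ∫⁻ y in U, lam ((fun x => (x, y)) ⁻¹' W) ∂ν := by
          refine setLIntegral_mono' hUm fun y hy => ?_
          simp only [hU, Set.mem_iUnion, mem_ball, exists_prop] at hy
          obtain ⟨x, hxS, hx⟩ := hy
          have e : volume (ball (0 : E) r) = volume (ball (y - x) r) := by
            exact (Measure.addHaar_ball_center volume (y - x) r).symm
          rw [e]
          have hsub : ball (y - x) r ⊆ ((fun x => (x, y)) ⁻¹' W) ∩ ball (0 : E) (5 * r) := by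
            intro t ht
            rw [mem_ball, dist_eq_norm] at ht
            rw [dist_eq_norm] at hx
            constructor
            · simp only [hW, Set.mem_preimage, Set.mem_iUnion, exists_prop]
              refine ⟨x, hxS, ?_⟩
              change dist y (x + t) < r
              have e1 : -(y - (x + t)) = t - (y - x) := by abel
              rw [dist_eq_norm, ← norm_neg, e1]
              exact ht
            · rw [mem_ball, dist_zero_right]
              have : ‖t‖ ≤ ‖t - (y - x)‖ + ‖y - x‖ := by
                simpa using norm_add_le (t - (y - x)) (y - x)
              linarith
          refine (measure_mono hsub).trans ?_
          exact (Measure.le_restrict_apply _ _)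
      _ ≤ _ := setLIntegral_le_lintegral _ _
  have h3 : volume (ball (0 : E) (5 * r)) = 5 ^ n * volume (ball (0 : E) r) := by
    rw [Measure.addHaar_ball_mul_of_pos volume (0 : E) (by norm_num : (0:ℝ) < 5) r]
    congr 1
    simp [E, ENNReal.ofReal_pow]
  have h4 : volume (ball (0 : E) r) ≠ 0 := (measure_ball_pos _ _ hr).ne'
  have h5 : volume (ball (0 : E) r) ≠ ⊤ := measure_ball_lt_top.ne
  have h6 := h2.trans h1
  rw [h3] at h6
  have h7 : volume (ball (0 : E) r) * ν U ≤ volume (ball (0 : E) r) * (5 ^ n * M) := by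
    refine h6.trans (le_of_eq ?_)
    ring
  exact (ENNReal.mul_le_mul_iff_right h4 h5).1 h7

/-- One greedy step. -/
lemma aux_step {n : ℕ} (ν : Measure (EuclideanSpace ℝ (Fin n))) [IsFiniteMeasure ν]
    (r : ℝ) (hr : 0 < r) (v δ : ENNReal) (hv : v ≠ 0)
    (hball : ∀ x, ν (ball x r) ≤ δ) (hV : v < ν Set.univ) :
    ∃ S : Finset (EuclideanSpace ℝ (Fin n)), v ≤ ν (⋃ x ∈ S, ball x r) ∧
      ν (⋃ x ∈ S, ball x (4 * r)) ≤ 5 ^ n * (v + δ) := by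
  classical
  have hex : ∃ p : ℕ, ∃ S : Finset (EuclideanSpace ℝ (Fin n)), S.card ≤ p ∧
      v ≤ ν (⋃ x ∈ S, ball x r) := by
    let d := TopologicalSpace.denseSeq (EuclideanSpace ℝ (Fin n))
    have hd : DenseRange d := TopologicalSpace.denseRange_denseSeq _
    have hun : (⋃ N : ℕ, ⋃ x ∈ (Finset.range N).image d, ball x r) = Set.univ := by
      refine Set.eq_univ_of_forall fun y => ?_
      obtain ⟨i, hi⟩ := hd.exists_dist_lt y hr
      simp only [Set.mem_iUnion]
      exact ⟨i + 1, d i, Finset.mem_image_of_mem _ (by simp), hi⟩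
    have hmono : Monotone fun N : ℕ => ⋃ x ∈ (Finset.range N).image d, ball x r := by
      intro a b hab
      exact Set.biUnion_subset_biUnion_left
        (Finset.image_subset_image (Finset.range_mono hab))
    have ht := tendsto_measure_iUnion_atTop (μ := ν) hmono
    rw [hun] at ht
    obtain ⟨N, hN⟩ := (ht.eventually (lt_mem_nhds hV)).exists
    exact ⟨_, _, le_rfl, hN.le⟩
  obtain ⟨S, hSc, hS⟩ := Nat.find_spec hex
  refine ⟨S, hS, aux_average ν r hr S _ fun t => ?_⟩
  have hSt : (⋃ x ∈ S, ball (x + t) r) = ⋃ x ∈ S.image (· + t), ball x r := by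
    rw [Finset.set_biUnion_finset_image]
  rw [hSt]
  have hc : (S.image (· + t)).card ≤ Nat.find hex := Finset.card_image_le.trans hSc
  generalize S.image (· + t) = T at hc
  rcases T.eq_empty_or_nonempty with rfl | ⟨x, hx⟩
  · simp
  · have hlt : (T.erase x).card < Nat.find hex :=
      (Finset.card_erase_lt_of_mem hx).trans_le hc
    have h1 := Nat.find_min hex hlt
    push Not at h1
    have h2 := h1 (T.erase x) le_rfl
    have h3 : (⋃ y ∈ T, ball y r) ⊆ (⋃ y ∈ T.erase x, ball y r) ∪ ball x r := by
      intro z hz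
      simp only [Set.mem_iUnion, exists_prop] at hz
      obtain ⟨y, hy, hz⟩ := hz
      by_cases hyx : y = x
      · subst hyx; exact Or.inr hz
      · left
        simp only [Set.mem_iUnion, exists_prop]
        exact ⟨y, Finset.mem_erase.2 ⟨hyx, hy⟩, hz⟩
    exact (measure_mono h3).trans ((measure_union_le _ _).trans (add_le_add h2.le (hball x)))

lemma aux_greedy {n : ℕ} (r : ℝ) (hr : 0 < r) (v δ : ENNReal) (hv : v ≠ 0) (j : ℕ) :
    ∀ (ν : Measure (EuclideanSpace ℝ (Fin n))) [IsFiniteMeasure ν],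
    (∀ x, ν (ball x r) ≤ δ) → (j : ENNReal) * (5 ^ n * (v + δ)) + v < ν Set.univ →
    ∃ A : Fin j → Set (EuclideanSpace ℝ (Fin n)),
      (∀ i, MeasurableSet (A i)) ∧ (∀ i, v ≤ ν (A i)) ∧
      (∀ i j, i ≠ j → ∀ a ∈ A i, ∀ b ∈ A j, 3 * r ≤ dist a b) := by
  induction j with
  | zero => 
    intro ν _ _ _
    exact ⟨fun _ => ∅, fun i => i.elim0, fun i => i.elim0, fun i => i.elim0⟩
  | succ j ih =>
    intro ν _ hball hV
    obtain ⟨S, hS1, hS2⟩ := aux_step ν r hr v δ hv hball (lt_of_le_of_lt le_add_self hV)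
    set U : Set (EuclideanSpace ℝ (Fin n)) := ⋃ x ∈ S, ball x (4 * r) with hU
    have hUm : MeasurableSet U := (isOpen_biUnion fun x _ => isOpen_ball).measurableSet
    obtain ⟨A, hAm, hAv, hAd⟩ := ih (ν.restrict Uᶜ)
      (fun x => (Measure.restrict_apply_le _ _).trans (hball x)) (by
        rw [Measure.restrict_apply_univ]
        by_contra hcon
        push Not at hcon
        refine absurd hV (not_lt.2 ?_)
        calc ν Set.univ = ν U + ν Uᶜ := (measure_add_measure_compl hUm).symm
          _ ≤ 5 ^ n * (v + δ) + (j * (5 ^ n * (v + δ)) + v) := add_le_add hS2 hcon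
          _ = _ := by push_cast; ring)
    have key : ∀ i, ∀ a ∈ (⋃ x ∈ S, ball x r), ∀ b ∈ A i ∩ Uᶜ, 3 * r ≤ dist a b := by
      intro i a ha b hb
      simp only [Set.mem_iUnion, exists_prop, mem_ball] at ha
      obtain ⟨x, hx, hax⟩ := ha
      have hb2 : ¬ dist b x < 4 * r := by
        intro h
        apply hb.2
        simp only [hU, Set.mem_iUnion, exists_prop, mem_ball]
        exact ⟨x, hx, h⟩
      have := dist_triangle b a x
      rw [dist_comm b a] at this
      linarith
    refine ⟨Fin.cons (⋃ x ∈ S, ball x r) (fun i => A i ∩ Uᶜ), ?_, ?_, ?_⟩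
    · intro i
      refine Fin.cases ?_ (fun i => ?_) i
      · exact (isOpen_biUnion fun x _ => isOpen_ball).measurableSet
      · exact (hAm i).inter hUm.compl
    · intro i
      refine Fin.cases ?_ (fun i => ?_) i
      · exact hS1
      · have := hAv i
        rwa [Measure.restrict_apply (hAm i)] at this
    · intro i i'
      refine Fin.cases ?_ (fun i => ?_) i <;> refine Fin.cases ?_ (fun i' => ?_) i'
      · intro h; exact absurd rfl h
      · intro _ a ha b hb
        exact key i' a ha b hb
      · intro _ a ha b hb
        rw [dist_comm]
        exact key i b hb a ha
      · intro h a ha b hb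
        exact hAd i i' (fun e => h (by rw [e])) a ha.1 b hb.1

open MeasureTheory Metric

/-- If `μ` is a finite nonzero Borel measure on `ℝ^n` with total mass `V`
satisfying `μ(B(x,r)) ≤ L·r^m` for all `x` and `r > 0`, and `k ≥ 1`, then with
`r₀ = (V/(12·8^{2n}·L·k))^{1/m}` there exist `k+1` measurable sets `A_1,…,A_{k+1}` with
`μ(A_i) ≥ V/(6·8^n·k)`, `μ(A_i^{r₀}) ≤ V/k`, and pairwise distance at least `3r₀`. -/
theorem exists_separated_sets_with_small_neighborhoods
    (m n : ℕ) (hm : 1 ≤ m) (hn : 1 ≤ n)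
    (μ : Measure (EuclideanSpace ℝ (Fin n)))
    (hμ0 : μ Set.univ ≠ 0) (hμfin : μ Set.univ ≠ ⊤)
    (L : ℝ) (hL : 0 < L)
    (hgrowth : ∀ (x : EuclideanSpace ℝ (Fin n)) (r : ℝ), 0 < r →
      μ (ball x r) ≤ ENNReal.ofReal (L * r ^ m))
    (k : ℕ) (hk : 1 ≤ k)
    (r₀ : ℝ)
    (hr₀ : r₀ = ((μ Set.univ).toReal / (12 * 8 ^ (2 * n) * L * k)) ^ ((1 : ℝ) / m)) :
    ∃ A : Fin (k + 1) → Set (EuclideanSpace ℝ (Fin n)),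
      (∀ i, MeasurableSet (A i)) ∧
      (∀ i, (μ Set.univ).toReal / (6 * 8 ^ n * k) ≤ (μ (A i)).toReal) ∧
      (∀ i, (μ (thickening r₀ (A i))).toReal ≤ (μ Set.univ).toReal / k) ∧
      (∀ i j, i ≠ j → ∀ a ∈ A i, ∀ b ∈ A j, 3 * r₀ ≤ dist a b) := by

  classical
  have hfm : IsFiniteMeasure μ := ⟨lt_top_iff_ne_top.2 hμfin⟩
  set V := (μ Set.univ).toReal with hVdef
  have hVpos : 0 < V := ENNReal.toReal_pos hμ0 hμfin
  have hkpos : (0 : ℝ) < k := by exact_mod_cast hk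
  have hr : 0 < r₀ := by rw [hr₀]; positivity
  have hrm : r₀ ^ m = V / (12 * 8 ^ (2 * n) * L * k) := by
    rw [hr₀, one_div]
    exact Real.rpow_inv_natCast_pow (by positivity) (by omega)
  set v : ℝ := V / (6 * 8 ^ n * k) with hv
  have hvpos : 0 < v := by positivity
  have hVv : V = 6 * 8 ^ n * k * v := by rw [hv]; field_simp
  have hLr : L * r₀ ^ m = v / (2 * 8 ^ n) := by
    rw [hrm, hv, pow_mul']; field_simp; norm_num
  have h8 : (8 : ℝ) ≤ 8 ^ n := le_self_pow₀ (by norm_num) (by omega)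
  have h58 : (5 : ℝ) ^ n ≤ 8 ^ n := pow_le_pow_left₀ (by norm_num) (by norm_num) n
  have hδ : L * r₀ ^ m ≤ v := by
    rw [hLr]
    exact div_le_self hvpos.le (by linarith)
  obtain ⟨A, hAm, hAv, hAd⟩ := aux_greedy (n := n) r₀ hr (ENNReal.ofReal v)
    (ENNReal.ofReal (L * r₀ ^ m)) (by simpa using hvpos) (2 * k) μ
    (fun x => hgrowth x r₀ hr) (by
      have e : μ Set.univ = ENNReal.ofReal V := (ENNReal.ofReal_toReal hμfin).symm
      have e2 : ((2 * k : ℕ) : ENNReal) * (5 ^ n * (ENNReal.ofReal v + ENNReal.ofReal (L * r₀ ^ m)))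
          + ENNReal.ofReal v
          = ENNReal.ofReal (((2 * k : ℕ) : ℝ) * (5 ^ n * (v + L * r₀ ^ m)) + v) := by
        have hw : 0 ≤ L * r₀ ^ m := by positivity
        generalize L * r₀ ^ m = w at hw
        rw [ENNReal.ofReal_add (by positivity) (by positivity),
          ENNReal.ofReal_mul (by positivity), ENNReal.ofReal_mul (by positivity),
          ENNReal.ofReal_add (by positivity) (by positivity),
          ENNReal.ofReal_pow (by positivity), ENNReal.ofReal_natCast]
        simp
      rw [e, e2]
      refine (ENNReal.ofReal_lt_ofReal_iff hVpos).2 ?_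
      have b1 : (5 : ℝ) ^ n * (v + L * r₀ ^ m) ≤ 8 ^ n * (2 * v) :=
        mul_le_mul h58 (by linarith) (by positivity) (by positivity)
      have b2 : (2 * k : ℝ) * (5 ^ n * (v + L * r₀ ^ m)) ≤ (2 * k) * (8 ^ n * (2 * v)) :=
        mul_le_mul_of_nonneg_left b1 (by positivity)
      have b3 : v < 2 * 8 ^ n * k * v := by
        have hk1 : (1 : ℝ) ≤ k := by exact_mod_cast hk
        have : (1 : ℝ) < 2 * 8 ^ n * k := by nlinarith
        nlinarith
      push_cast
      rw [hVv]
      linarith)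
  have hdisj : Pairwise (Function.onFun Disjoint fun i => thickening r₀ (A i)) := by
    intro i j hij
    refine Set.disjoint_left.2 fun x hxi hxj => ?_
    obtain ⟨a, ha, hxa⟩ := mem_thickening_iff.1 hxi
    obtain ⟨b, hb, hxb⟩ := mem_thickening_iff.1 hxj
    have h1 := hAd i j hij a ha b hb
    have h2 := dist_triangle_left a b x
    linarith
  have hsum : ∑ i, (μ (thickening r₀ (A i))).toReal ≤ V := by
    rw [← ENNReal.toReal_sum (fun i _ => measure_ne_top _ _)]
    refine ENNReal.toReal_mono hμfin ?_
    rw [← measure_biUnion_finset (fun i _ j _ hij => hdisj hij)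
      (fun i _ => isOpen_thickening.measurableSet)]
    exact measure_mono (Set.subset_univ _)
  set G : Finset (Fin (2 * k)) :=
    Finset.univ.filter fun i => (μ (thickening r₀ (A i))).toReal ≤ V / k with hG
  set Bd : Finset (Fin (2 * k)) :=
    Finset.univ.filter fun i => ¬ (μ (thickening r₀ (A i))).toReal ≤ V / k with hBd
  have hcard : G.card + Bd.card = 2 * k := by
    rw [hG, hBd, Finset.card_filter_add_card_filter_not]; simp
  have hBdc : Bd.card < k := by
    by_contra hcon
    push Not at hcon
    have hne : Bd.Nonempty := Finset.card_pos.1 (by omega)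
    have h1 : ∑ i ∈ Bd, V / k < ∑ i ∈ Bd, (μ (thickening r₀ (A i))).toReal :=
      Finset.sum_lt_sum_of_nonempty hne fun i hi => not_le.1 (Finset.mem_filter.1 hi).2
    have h2 : ∑ i ∈ Bd, (μ (thickening r₀ (A i))).toReal ≤ V :=
      (Finset.sum_le_sum_of_subset_of_nonneg (Finset.subset_univ _)
        fun i _ _ => ENNReal.toReal_nonneg).trans hsum
    rw [Finset.sum_const, nsmul_eq_mul] at h1
    have h3 : (k : ℝ) * (V / k) ≤ Bd.card * (V / k) :=
      mul_le_mul_of_nonneg_right (by exact_mod_cast hcon) (by positivity)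
    rw [mul_div_cancel₀ _ hkpos.ne'] at h3
    linarith
  obtain ⟨G', hG'G, hG'c⟩ := Finset.exists_subset_card_eq (show k + 1 ≤ G.card by omega)
  let f := G'.orderEmbOfFin hG'c
  have hf : ∀ i, f i ∈ G := fun i => hG'G (Finset.orderEmbOfFin_mem G' hG'c i)
  refine ⟨fun i => A (f i), fun i => hAm _, fun i => ?_, fun i => ?_, fun i j hij => ?_⟩
  · exact (ENNReal.ofReal_le_iff_le_toReal (measure_ne_top _ _)).1 (hAv (f i))
  · exact (Finset.mem_filter.1 (hf i)).2
  · exact hAd _ _ (fun e => hij (f.injective e))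
end

section
/- Let m ≥ 1 and n ≥ 1 be integers, μ a Borel measure on ℝ^n with 0 < V := μ(ℝ^n) < ∞, L > 0 a real number such that μ(B(x,r)) ≤ L·r^m for every x ∈ ℝ^n and every r > 0, and k ≥ 1 an integer. Set r₀ = (V/(12·8^{2n}·L·k))^{1/m}. Then there exist k+1 functions φ_1, …, φ_{k+1} : ℝ^n → [0,1] such that: (i) each φ_i is Lipschitz with Lipschitz constant 1/r₀; (ii) the supports {φ_i ≠ 0} are pairwise disjoint; (iii) ∫ φ_i² dμ ≥ V/(6·8^n·k) for each i; and (iv) μ({φ_i ≠ 0}) ≤ V/k for each i. In particular, for each i, (1/r₀²)·μ({φ_i ≠ 0}) / ∫ φ_i² dμ ≤ 6·8^n·(12·8^{2n})^{2/m}·L^{2/m}·(k/V)^{2/m}. -/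
open MeasureTheory Metric

lemma cover_aux {n : ℕ} (x : EuclideanSpace ℝ (Fin n)) (s : ℝ) (hs : 0 < s) :
    ∃ F : Finset (EuclideanSpace ℝ (Fin n)), F.card ≤ 5 ^ n ∧
      ball x (2 * s) ⊆ ⋃ y ∈ F, ball y s := by
  classical
  let E := EuclideanSpace ℝ (Fin n)
  let P : ℕ → Prop := fun N => ∃ G : Finset E, G.card = N ∧ (∀ c ∈ G, ‖c‖ ≤ 2) ∧
    ∀ c ∈ G, ∀ d ∈ G, c ≠ d → 1 ≤ ‖c - d‖
  have hP0 : P 0 := ⟨∅, by simp⟩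
  have hPb : ∀ N, P N → N ≤ 5 ^ n := by
    rintro N ⟨G, rfl, h1, h2⟩
    have := Besicovitch.card_le_of_separated G h1 h2
    simpa [E] using this
  obtain ⟨G, hGc, hG2, hGs⟩ : P (Nat.findGreatest P (5 ^ n)) :=
    Nat.findGreatest_spec (Nat.zero_le _) hP0
  have hmax : ∀ z : E, ‖z‖ ≤ 2 → ∃ c ∈ G, ‖z - c‖ < 1 := by
    intro z hz
    by_contra! hcon
    have hzG : z ∉ G := fun h => by
      have := hcon z h
      simp at this
      linarith
    have hP : P (Nat.findGreatest P (5 ^ n) + 1) := by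
      refine ⟨insert z G, by rw [Finset.card_insert_of_notMem hzG, hGc], ?_, ?_⟩
      · intro c hc
        rcases Finset.mem_insert.1 hc with rfl | hc
        · exact hz
        · exact hG2 c hc
      · intro c hc d hd hcd
        rcases Finset.mem_insert.1 hc with h1 | h1 <;> rcases Finset.mem_insert.1 hd with h2 | h2
        · exact absurd (h1.trans h2.symm) hcd
        · rw [h1]; exact hcon d h2
        · rw [norm_sub_rev, h2]; exact hcon c h1
        · exact hGs c h1 d h2 hcd
    have := Nat.le_findGreatest (hPb _ hP) hP
    omega
  refine ⟨G.image (fun c => x + s • c), Finset.card_image_le.trans ?_, ?_⟩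
  · rw [hGc]; exact Nat.findGreatest_le _
  · intro y hy
    have hy' : ‖y - x‖ < 2 * s := by simpa [mem_ball, dist_eq_norm] using hy
    obtain ⟨c, hc, hcy⟩ := hmax (s⁻¹ • (y - x)) (by
      rw [norm_smul, Real.norm_of_nonneg (by positivity), inv_mul_le_iff₀ hs]
      linarith)
    simp only [Set.mem_iUnion]
    refine ⟨x + s • c, Finset.mem_image_of_mem _ hc, ?_⟩
    rw [mem_ball, dist_eq_norm]
    have : y - (x + s • c) = s • (s⁻¹ • (y - x) - c) := by
      rw [smul_sub, smul_smul, mul_inv_cancel₀ hs.ne', one_smul]; abel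
    rw [this, norm_smul, Real.norm_of_nonneg hs.le]
    nlinarith

lemma cover_meas {n : ℕ} (μ : Measure (EuclideanSpace ℝ (Fin n))) [IsFiniteMeasure μ]
    (X : Set (EuclideanSpace ℝ (Fin n)))
    (x : EuclideanSpace ℝ (Fin n)) (s : ℝ) (hs : 0 < s) (b : ℝ)
    (hb : ∀ y, μ.real (X ∩ ball y s) ≤ b) : μ.real (X ∩ ball x (2 * s)) ≤ 5 ^ n * b := by
  obtain ⟨F, hF, hc⟩ := cover_aux x s hs
  have hb0 : 0 ≤ b := measureReal_nonneg.trans (hb x)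
  calc μ.real (X ∩ ball x (2 * s)) ≤ μ.real (⋃ y ∈ F, (X ∩ ball y s)) := by
        apply measureReal_mono _ (measure_ne_top _ _)
        rintro z ⟨hz, hz2⟩
        have := hc hz2
        simp only [Set.mem_iUnion] at this ⊢
        obtain ⟨y, hy, h⟩ := this
        exact ⟨y, hy, hz, h⟩
    _ ≤ ∑ y ∈ F, μ.real (X ∩ ball y s) := measureReal_biUnion_finset_le _ _
    _ ≤ ∑ y ∈ F, b := Finset.sum_le_sum fun y _ => hb y
    _ = F.card * b := by simp
    _ ≤ 5 ^ n * b := by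
        gcongr
        exact_mod_cast hF

lemma choice_aux {n : ℕ} (hn : 1 ≤ n) (μ : Measure (EuclideanSpace ℝ (Fin n))) [IsFiniteMeasure μ]
    (s : ℝ) (X : Set (EuclideanSpace ℝ (Fin n))) :
    ∃ x, ∀ y, 5 ^ n * μ.real (X ∩ ball y s) ≤ 8 ^ n * μ.real (X ∩ ball x s) := by
  let f : EuclideanSpace ℝ (Fin n) → ℝ := fun y => μ.real (X ∩ ball y s)
  have hbdd : BddAbove (Set.range f) := by
    refine ⟨μ.real Set.univ, ?_⟩
    rintro _ ⟨y, rfl⟩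
    exact measureReal_mono (Set.subset_univ _) (measure_ne_top _ _)
  have hf0 : ∀ y, 0 ≤ f y := fun y => measureReal_nonneg
  have hle : ∀ y, f y ≤ ⨆ y, f y := fun y => le_ciSup hbdd y
  rcases (le_trans (hf0 0) (hle 0)).eq_or_lt with h | h
  · refine ⟨0, fun y => ?_⟩
    have : f y = 0 := le_antisymm (h ▸ hle y) (hf0 y)
    change 5 ^ n * f y ≤ 8 ^ n * f 0
    rw [this, mul_zero]
    exact mul_nonneg (by positivity) (hf0 0)
  · have h58 : (5 / 8 : ℝ) ^ n < 1 := pow_lt_one₀ (by norm_num) (by norm_num) (by omega)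
    obtain ⟨x, hx⟩ := exists_lt_of_lt_ciSup (show (5 / 8 : ℝ) ^ n * (⨆ y, f y) < ⨆ y, f y by nlinarith)
    refine ⟨x, fun y => ?_⟩
    change 5 ^ n * f y ≤ 8 ^ n * f x
    rw [div_pow, div_mul_eq_mul_div, div_lt_iff₀ (by positivity)] at hx
    have := mul_le_mul_of_nonneg_left (hle y) (show (0 : ℝ) ≤ 5 ^ n by positivity)
    linarith

/-- Greedy carving. -/
lemma carve {n : ℕ} (hn : 1 ≤ n) (μ : Measure (EuclideanSpace ℝ (Fin n))) [IsFiniteMeasure μ]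
    (r : ℝ) (hr : 0 < r) :
    ∃ A : ℕ → Set (EuclideanSpace ℝ (Fin n)),
      (∀ j, MeasurableSet (A j)) ∧ (∀ j, ∃ x, A j ⊆ ball x (2 * r)) ∧
      (∀ i j, i ≠ j → ∀ a ∈ A i, ∀ b ∈ A j, 2 * r ≤ dist a b) ∧
      ∀ c, 8 ^ n * c < μ.real Set.univ → ∃ J, c < ∑ j ∈ Finset.range J, μ.real (A j) := by
  choose ch hch using fun X => choice_aux hn μ (2 * r) X
  let R : ℕ → Set (EuclideanSpace ℝ (Fin n)) :=
    fun j => Nat.rec ∅ (fun _ S => S ∪ ball (ch Sᶜ) (2 * (2 * r))) j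
  have hRs : ∀ j, R (j + 1) = R j ∪ ball (ch (R j)ᶜ) (2 * (2 * r)) := fun j => rfl
  have hR0 : R 0 = ∅ := rfl
  let A : ℕ → Set (EuclideanSpace ℝ (Fin n)) := fun j => (R j)ᶜ ∩ ball (ch (R j)ᶜ) (2 * r)
  have hRm : ∀ j, MeasurableSet (R j) := by
    intro j
    induction j with
    | zero => rw [hR0]; exact MeasurableSet.empty
    | succ j ih => rw [hRs]; exact ih.union measurableSet_ball
  have hmono : Monotone R := monotone_nat_of_le_succ fun j => by
    rw [hRs]; exact Set.subset_union_left
  have hsep : ∀ i j, i < j → ∀ a ∈ A i, ∀ b ∈ A j, 2 * r ≤ dist a b := by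
    intro i j hij a ha b hb
    have h1 : b ∉ R (i + 1) := fun h => hb.1 (hmono (Nat.succ_le_of_lt hij) h)
    rw [hRs] at h1
    have h2 : ¬ dist b (ch (R i)ᶜ) < 2 * (2 * r) := fun h => h1 (Or.inr h)
    have h3 : dist a (ch (R i)ᶜ) < 2 * r := ha.2
    have h4 := dist_triangle b a (ch (R i)ᶜ)
    rw [dist_comm b a] at h4
    linarith
  refine ⟨A, fun j => (hRm j).compl.inter measurableSet_ball,
    fun j => ⟨_, Set.inter_subset_right⟩, ?_, ?_⟩
  · intro i j hij a ha b hb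
    rcases lt_or_gt_of_ne hij with h | h
    · exact hsep i j h a ha b hb
    · rw [dist_comm]; exact hsep j i h b hb a ha
  intro c hc
  by_contra! hcon
  have hstep : ∀ j, μ.real ((R j)ᶜ ∩ ball (ch (R j)ᶜ) (2 * (2 * r))) ≤ 8 ^ n * μ.real (A j) := by
    intro j
    have := cover_meas μ (R j)ᶜ (ch (R j)ᶜ) (2 * r) (by positivity) (8 ^ n * μ.real (A j) / 5 ^ n)
      (fun y => by
        rw [le_div_iff₀ (by positivity), mul_comm]
        exact hch (R j)ᶜ y)
    rwa [mul_div_cancel₀ _ (by positivity)] at this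
  have hRle : ∀ J, μ.real (R J) ≤ 8 ^ n * ∑ j ∈ Finset.range J, μ.real (A j) := by
    intro J
    induction J with
    | zero => simp [hR0]
    | succ J ih =>
      have : R (J + 1) = R J ∪ ((R J)ᶜ ∩ ball (ch (R J)ᶜ) (2 * (2 * r))) := by
        rw [hRs]; ext z
        simp only [Set.mem_union, Set.mem_inter_iff, Set.mem_compl_iff]
        tauto
      rw [this, Finset.sum_range_succ, mul_add]
      exact (measureReal_union_le _ _).trans (add_le_add ih (hstep J))
  have hsum : Summable fun j => μ.real (A j) :=
    summable_of_sum_range_le (fun _ => measureReal_nonneg) hcon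
  have hlim := hsum.tendsto_atTop_zero
  have hnull : μ (⋃ j, R j)ᶜ = 0 := by
    apply measure_null_of_locally_null
    intro y _
    refine ⟨(⋃ j, R j)ᶜ ∩ ball y (2 * r), ?_, ?_⟩
    · exact inter_mem_nhdsWithin _ (ball_mem_nhds _ (by positivity))
    · have hle : ∀ j, 5 ^ n * μ.real ((⋃ j, R j)ᶜ ∩ ball y (2 * r)) ≤ 8 ^ n * μ.real (A j) := by
        intro j
        refine le_trans ?_ (hch (R j)ᶜ y)
        gcongr
        · exact measure_ne_top _ _
        · exact Set.subset_iUnion R j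
      have h0 : 5 ^ n * μ.real ((⋃ j, R j)ᶜ ∩ ball y (2 * r)) ≤ 8 ^ n * 0 :=
        ge_of_tendsto' (hlim.const_mul _) hle
      have h1 : μ.real ((⋃ j, R j)ᶜ ∩ ball y (2 * r)) = 0 := by
        apply le_antisymm _ measureReal_nonneg
        by_contra! h
        have : (0 : ℝ) < 5 ^ n * μ.real ((⋃ j, R j)ᶜ ∩ ball y (2 * r)) := by positivity
        linarith
      exact (measureReal_eq_zero_iff (measure_ne_top _ _)).1 h1
  have hUm : MeasurableSet (⋃ j, R j) := MeasurableSet.iUnion hRm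
  have hU : μ (⋃ j, R j) = μ Set.univ := by
    rw [← measure_add_measure_compl hUm, hnull, add_zero]
  have ht := tendsto_measure_iUnion_atTop (μ := μ) hmono
  rw [hU] at ht
  have ht' := (ENNReal.tendsto_toReal (measure_ne_top μ Set.univ)).comp ht
  have : μ.real Set.univ ≤ 8 ^ n * c := le_of_tendsto' ht' fun J =>
    (hRle J).trans (mul_le_mul_of_nonneg_left (hcon J) (by positivity))
  linarith

lemma group_aux (a : ℕ → ℝ) (ha : ∀ j, 0 ≤ a j) (δ τ : ℝ) (hτ : 0 ≤ τ) (hδ : ∀ j, a j ≤ δ) (K : ℕ)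
    (J : ℕ) (hJ : K * τ ≤ ∑ j ∈ Finset.range J, a j) :
    ∃ p : ℕ → ℕ, Monotone p ∧
      ∀ i < K, τ - δ ≤ ∑ j ∈ Finset.Ico (p i) (p (i + 1)), a j := by
  classical
  let S : ℕ → ℝ := fun q => ∑ j ∈ Finset.range q, a j
  have hδ0 : 0 ≤ δ := (ha 0).trans (hδ 0)
  have hex : ∀ i : ℕ, ∃ q, (min i K : ℕ) * τ ≤ S q := fun i =>
    ⟨J, le_trans (by gcongr; exact min_le_right _ _) hJ⟩
  let p : ℕ → ℕ := fun i => Nat.find (hex i)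
  have hp : ∀ i, (min i K : ℕ) * τ ≤ S (p i) := fun i => Nat.find_spec (hex i)
  have hmono : Monotone p := by
    intro i j hij
    apply Nat.find_min'
    refine le_trans ?_ (hp j)
    gcongr
  have hup : ∀ i, S (p i) ≤ (min i K : ℕ) * τ + δ := by
    intro i
    rcases h : p i with _ | q
    · simp only [S, Finset.range_zero, Finset.sum_empty]; positivity
    · have h1 : ¬ (min i K : ℕ) * τ ≤ S q := Nat.find_min (hex i) (show q < p i by omega)
      have h2 : S (q + 1) = S q + a q := Finset.sum_range_succ _ _
      have := hδ q
      linarith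
  refine ⟨p, hmono, fun i hi => ?_⟩
  rw [Finset.sum_Ico_eq_sub _ (hmono (Nat.le_succ i))]
  have h1 := hp (i + 1)
  have h2 := hup i
  rw [min_eq_left (by omega)] at h1 h2
  push_cast at h1
  change τ - δ ≤ S _ - S _
  linarith

lemma bump {n : ℕ} (μ : Measure (EuclideanSpace ℝ (Fin n))) [IsFiniteMeasure μ]
    (A : Set (EuclideanSpace ℝ (Fin n))) (hA : MeasurableSet A) (hne : A.Nonempty)
    (r : ℝ) (hr : 0 < r) :
    ∃ φ : EuclideanSpace ℝ (Fin n) → ℝ, (∀ x, φ x ∈ Set.Icc (0 : ℝ) 1) ∧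
      LipschitzWith (Real.toNNReal (1 / r)) φ ∧ Function.support φ = thickening r A ∧
      μ.real A ≤ ∫ x, (φ x) ^ 2 ∂μ := by
  let φ : EuclideanSpace ℝ (Fin n) → ℝ := fun x => max 0 (1 - infDist x A / r)
  have hIcc : ∀ x, φ x ∈ Set.Icc (0 : ℝ) 1 := fun x =>
    ⟨le_max_left _ _, max_le zero_le_one (by
      have : 0 ≤ infDist x A / r := div_nonneg infDist_nonneg hr.le
      linarith)⟩
  have hlip : LipschitzWith (Real.toNNReal (1 / r)) φ := by
    apply LipschitzWith.const_max
    apply LipschitzWith.of_le_add_mul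
    intro x y
    rw [Real.coe_toNNReal _ (by positivity)]
    have h : infDist y A ≤ infDist x A + dist x y := by
      rw [dist_comm]; exact infDist_le_infDist_add_dist
    have h2 : infDist y A / r ≤ (infDist x A + dist x y) / r := by gcongr
    rw [add_div] at h2
    rw [one_div_mul_eq_div]
    linarith
  refine ⟨φ, hIcc, hlip, ?_, ?_⟩
  · ext x
    rw [mem_thickening_iff_infDist_lt hne, Function.mem_support]
    constructor
    · intro h
      by_contra! h2
      apply h
      have : 1 ≤ infDist x A / r := by rwa [one_le_div hr]
      exact max_eq_left (by linarith)
    · intro h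
      have : infDist x A / r < 1 := by rwa [div_lt_one hr]
      exact ne_of_gt (lt_max_of_lt_right (by linarith))
  · have hint : Integrable (fun x => φ x ^ 2) μ := by
      apply Integrable.of_bound (hlip.continuous.pow 2).aestronglyMeasurable 1
      filter_upwards with x
      change ‖φ x ^ 2‖ ≤ 1
      rw [Real.norm_of_nonneg (sq_nonneg _)]
      exact pow_le_one₀ (hIcc x).1 (hIcc x).2
    rw [← integral_indicator_one hA]
    apply integral_mono ((integrable_const (1 : ℝ)).indicator hA) hint
    intro x
    by_cases hx : x ∈ A
    · simp [hx, φ, infDist_zero_of_mem hx]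
    · simp [hx, sq_nonneg]

/-- Under the volume growth hypothesis `μ(B(x,r)) ≤ L·r^m`, with
`r₀ = (V/(12·8^{2n}·L·k))^{1/m}`, there exist `k+1` test functions `φ_i : ℝ^n → [0,1]`
that are `(1/r₀)`-Lipschitz, have pairwise disjoint supports, satisfy
`∫ φ_i² dμ ≥ V/(6·8^n·k)` and `μ({φ_i ≠ 0}) ≤ V/k`; in particular their "Rayleigh
quotients" `(1/r₀²)·μ({φ_i ≠ 0})/∫ φ_i² dμ` are bounded by
`6·8^n·(12·8^{2n})^{2/m}·L^{2/m}·(k/V)^{2/m}`. -/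
theorem exists_test_functions
    (m n : ℕ) (hm : 1 ≤ m) (hn : 1 ≤ n)
    (μ : Measure (EuclideanSpace ℝ (Fin n)))
    (hμ0 : μ Set.univ ≠ 0) (hμfin : μ Set.univ ≠ ⊤)
    (L : ℝ) (hL : 0 < L)
    (hgrowth : ∀ (x : EuclideanSpace ℝ (Fin n)) (r : ℝ), 0 < r →
      μ (ball x r) ≤ ENNReal.ofReal (L * r ^ m))
    (k : ℕ) (hk : 1 ≤ k)
    (r₀ : ℝ)
    (hr₀ : r₀ = ((μ Set.univ).toReal / (12 * 8 ^ (2 * n) * L * k)) ^ ((1 : ℝ) / m)) :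
    ∃ φ : Fin (k + 1) → EuclideanSpace ℝ (Fin n) → ℝ,
      (∀ i x, φ i x ∈ Set.Icc (0 : ℝ) 1) ∧
      (∀ i, LipschitzWith (Real.toNNReal (1 / r₀)) (φ i)) ∧
      (Pairwise fun i j => Disjoint (Function.support (φ i)) (Function.support (φ j))) ∧
      (∀ i, (μ Set.univ).toReal / (6 * 8 ^ n * k) ≤ ∫ x, (φ i x) ^ 2 ∂μ) ∧
      (∀ i, (μ (Function.support (φ i))).toReal ≤ (μ Set.univ).toReal / k) ∧
      (∀ i, 1 / r₀ ^ 2 * (μ (Function.support (φ i))).toReal / ∫ x, (φ i x) ^ 2 ∂μ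
        ≤ 6 * 8 ^ n * ((12 * 8 ^ (2 * n) : ℝ) ^ ((2 : ℝ) / m))
            * L ^ ((2 : ℝ) / m) * ((k : ℝ) / (μ Set.univ).toReal) ^ ((2 : ℝ) / m)) := by
  have : IsFiniteMeasure μ := ⟨lt_top_iff_ne_top.2 hμfin⟩
  have hV : 0 < (μ Set.univ).toReal := ENNReal.toReal_pos hμ0 hμfin
  set V : ℝ := (μ Set.univ).toReal with hVdef
  have hkR : (1 : ℝ) ≤ k := by exact_mod_cast hk
  have hk0 : (0 : ℝ) < k := by linarith
  have hbase : 0 < V / (12 * 8 ^ (2 * n) * L * k) := by positivity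
  have hr : 0 < r₀ := by rw [hr₀]; exact Real.rpow_pos_of_pos hbase _
  have hm0 : (m : ℝ) ≠ 0 := by exact_mod_cast (by omega : m ≠ 0)
  have hrm : r₀ ^ m = V / (12 * 8 ^ (2 * n) * L * k) := by
    rw [hr₀, ← Real.rpow_natCast, ← Real.rpow_mul hbase.le, one_div_mul_cancel hm0, Real.rpow_one]
  have hr2 : r₀ ^ 2 = (V / (12 * 8 ^ (2 * n) * L * k)) ^ ((2 : ℝ) / m) := by
    rw [hr₀, ← Real.rpow_natCast, ← Real.rpow_mul hbase.le]
    congr 1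
    push_cast
    ring
  set t : ℝ := V / (6 * 8 ^ n * k) with ht
  have ht0 : 0 < t := by positivity
  have hball : ∀ y, μ.real (ball y r₀) ≤ t / (2 * 8 ^ n) := by
    intro y
    have h1 := ENNReal.toReal_le_of_le_ofReal (by positivity) (hgrowth y r₀ hr)
    refine h1.trans (le_of_eq ?_)
    rw [hrm, ht, pow_mul']
    field_simp
    ring
  have h58 : (5 : ℝ) ^ n / 8 ^ n ≤ 5 / 8 := by
    rw [← div_pow]
    calc (5 / 8 : ℝ) ^ n ≤ (5 / 8) ^ 1 :=
          pow_le_pow_of_le_one (by norm_num) (by norm_num) hn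
      _ = 5 / 8 := pow_one _
  obtain ⟨A, hAm, hAb, hAs, hAsum⟩ := carve hn μ r₀ hr
  have hAδ : ∀ j, μ.real (A j) ≤ t / 2 := by
    intro j
    obtain ⟨x, hx⟩ := hAb j
    have h1 := cover_meas μ Set.univ x r₀ hr (t / (2 * 8 ^ n)) (fun y => by
      rw [Set.univ_inter]; exact hball y)
    rw [Set.univ_inter] at h1
    refine (measureReal_mono hx (measure_ne_top _ _)).trans (h1.trans ?_)
    have : (5 : ℝ) ^ n * (t / (2 * 8 ^ n)) = (5 ^ n / 8 ^ n) * (t / 2) := by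
      field_simp
    rw [this]
    nlinarith
  have hVt : V = 8 ^ n * (6 * k * t) := by
    rw [ht]; field_simp
  obtain ⟨J, hJ⟩ := hAsum ((3 * k : ℕ) * (3 / 2 * t)) (by
    change _ < V
    rw [hVt]
    push_cast
    have : 0 < k * t := by positivity
    gcongr 8 ^ n * ?_
    linarith)
  obtain ⟨p, hpm, hp⟩ := group_aux (fun j => μ.real (A j)) (fun _ => measureReal_nonneg)
    (t / 2) (3 / 2 * t) (by positivity) hAδ (3 * k) J hJ.le
  let G : ℕ → Set (EuclideanSpace ℝ (Fin n)) :=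
    fun i => ⋃ j ∈ Finset.Ico (p i) (p (i + 1)), A j
  have hGm : ∀ i, MeasurableSet (G i) := fun i =>
    Finset.measurableSet_biUnion _ fun j _ => hAm j
  have hGt : ∀ i < 3 * k, t ≤ μ.real (G i) := by
    intro i hi
    have h1 := hp i hi
    have h2 : μ.real (G i) = ∑ j ∈ Finset.Ico (p i) (p (i + 1)), μ.real (A j) := by
      apply measureReal_biUnion_finset
      · intro a _ b _ hab
        refine Set.disjoint_left.2 fun z hz hz' => ?_
        have := hAs a b hab z hz z hz'
        rw [dist_self] at this
        linarith
      · exact fun j _ => hAm j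
      · exact fun j _ => measure_ne_top _ _
    rw [h2]
    linarith
  have hGs : ∀ i j, i < j → Disjoint (thickening r₀ (G i)) (thickening r₀ (G j)) := by
    intro i j hij
    refine Set.disjoint_left.2 fun z hz hz' => ?_
    rw [mem_thickening_iff] at hz hz'
    obtain ⟨a, ha, hza⟩ := hz
    obtain ⟨b, hb, hzb⟩ := hz'
    simp only [G, Set.mem_iUnion, Finset.mem_Ico] at ha hb
    obtain ⟨u, hu, ha⟩ := ha
    obtain ⟨v, hv, hb⟩ := hb
    have h1 : p (i + 1) ≤ p j := hpm hij
    have h2 := hAs u v (by omega) a ha b hb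
    have h3 := dist_triangle_left a b z
    linarith
  have hGs' : ∀ i j, i ≠ j → Disjoint (thickening r₀ (G i)) (thickening r₀ (G j)) := by
    intro i j hij
    rcases lt_or_gt_of_ne hij with h | h
    · exact hGs i j h
    · exact (hGs j i h).symm
  -- choose the light ones
  classical
  let good : Finset ℕ := (Finset.range (3 * k)).filter
    fun i => μ.real (thickening r₀ (G i)) ≤ V / k
  let bad : Finset ℕ := (Finset.range (3 * k)).filter
    fun i => ¬ μ.real (thickening r₀ (G i)) ≤ V / k
  have hcard : good.card + bad.card = 3 * k := by
    rw [Finset.card_filter_add_card_filter_not, Finset.card_range]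
  have hbad : bad.card ≤ k := by
    have h1 : ∑ i ∈ bad, μ.real (thickening r₀ (G i)) ≤ V :=
      sum_measureReal_le_measureReal_univ
        (fun i _ => isOpen_thickening.measurableSet)
        (fun i _ j _ hij => hGs' i j hij)
    have h2 : bad.card * (V / k) ≤ ∑ i ∈ bad, μ.real (thickening r₀ (G i)) := by
      rw [← nsmul_eq_mul]
      exact Finset.card_nsmul_le_sum _ _ _ fun i hi =>
        (not_le.1 (Finset.mem_filter.1 hi).2).le
    have h3 := h2.trans h1
    rw [mul_div_assoc', div_le_iff₀ hk0, mul_comm] at h3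
    exact_mod_cast le_of_mul_le_mul_left h3 hV
  have hgood : k + 1 ≤ good.card := by omega
  obtain ⟨T, hTg, hTc⟩ := Finset.exists_subset_card_eq hgood
  let e : Fin (k + 1) ↪o ℕ := T.orderEmbOfFin hTc
  have he : ∀ i, e i ∈ good := fun i => hTg (T.orderEmbOfFin_mem hTc i)
  have helt : ∀ i, e i < 3 * k := fun i => Finset.mem_range.1 (Finset.mem_filter.1 (he i)).1
  have hne : ∀ i, (G (e i)).Nonempty := by
    intro i
    by_contra h
    have h1 := hGt _ (helt i)
    rw [Set.not_nonempty_iff_eq_empty.1 h, measureReal_empty] at h1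
    linarith
  choose φ hφ1 hφ2 hφ3 hφ4 using fun i => bump μ (G (e i)) (hGm _) (hne i) r₀ hr
  have hI : ∀ i, t ≤ ∫ x, (φ i x) ^ 2 ∂μ := fun i => (hGt _ (helt i)).trans (hφ4 i)
  have hS : ∀ i, (μ (Function.support (φ i))).toReal ≤ V / k := by
    intro i
    rw [hφ3]
    exact (Finset.mem_filter.1 (he i)).2
  refine ⟨φ, hφ1, hφ2, ?_, hI, hS, ?_⟩
  · intro i j hij
    change Disjoint (Function.support (φ i)) (Function.support (φ j))
    rw [hφ3, hφ3]
    exact hGs' _ _ fun h => hij (e.injective h)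
  · intro i
    have h1 : 1 / r₀ ^ 2 * (μ (Function.support (φ i))).toReal / ∫ x, (φ i x) ^ 2 ∂μ
        ≤ 1 / r₀ ^ 2 * (V / k) / t := by
      gcongr
      · exact hS i
      · exact hI i
    refine h1.trans (le_of_eq ?_)
    have h2 : 1 / r₀ ^ 2 * (V / k) / t = 6 * 8 ^ n * (1 / r₀ ^ 2) := by
      rw [ht]; field_simp
    have h3 : 1 / r₀ ^ 2 = (12 * 8 ^ (2 * n) : ℝ) ^ ((2 : ℝ) / m) * L ^ ((2 : ℝ) / m)
        * ((k : ℝ) / V) ^ ((2 : ℝ) / m) := by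
      rw [hr2, one_div, ← Real.inv_rpow hbase.le, ← Real.mul_rpow (by positivity) hL.le,
        ← Real.mul_rpow (by positivity) (by positivity)]
      congr 1
      field_simp
    rw [h2, h3]
    ring
end
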